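/- arXiv:2402.05053 — 9 statements merged into one kernel-verified Lean document; each statement's English description precedes it below -/
import Mathlib

section
/- Let m be a natural number and, for each k < m, let r_k be an even integer and s_k a nonzero odd integer. Then the product ∏_{k < m} exp(π · i · (r_k / s_k)) is not equal to -1. -/
/-- A phase `exp(π i r / s)` with `r` even and `s` nonzero is an `s`-th root of unity. -/
lemma exp_pi_mul_I_mul_div_zpow_eq_one {r s : ℤ} (hr : Even r) (hs : s ≠ 0) :
    Complex.exp (Real.pi * Complex.I * ((r : ℂ) / (s : ℂ))) ^ s = 1 := by
  obtain ⟨a, rfl⟩ := hr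
  have hs' : (s : ℂ) ≠ 0 := Int.cast_ne_zero.mpr hs
  rw [← Complex.exp_int_mul, Complex.exp_eq_one_iff]
  refine ⟨a, ?_⟩
  push_cast
  field_simp
  ring

/-- A product of phases `exp(π i r_k / s_k)` with each `r_k` even and each
`s_k` a nonzero odd integer is never `-1`. -/
theorem prod_low_precision_phases_ne_neg_one (m : ℕ) (r s : Fin m → ℤ)
    (hr : ∀ k, Even (r k)) (hs0 : ∀ k, s k ≠ 0) (hs : ∀ k, Odd (s k)) :
    ∏ k, Complex.exp (Real.pi * Complex.I * ((r k : ℂ) / (s k : ℂ))) ≠ -1 := by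
  intro h
  have hodd : Odd (∏ k, s k) :=
    Finset.prod_induction s Odd (fun _ _ => Odd.mul) odd_one fun k _ => hs k
  have hone : (∏ k, Complex.exp (Real.pi * Complex.I * ((r k : ℂ) / (s k : ℂ)))) ^ (∏ k, s k)
      = 1 := by
    rw [← Finset.prod_zpow]
    refine Finset.prod_eq_one fun k hk => ?_
    obtain ⟨c, hc⟩ := Finset.dvd_prod_of_mem s hk
    rw [hc, zpow_mul, exp_pi_mul_I_mul_div_zpow_eq_one (hr k) (hs0 k), one_zpow]
  rw [h, hodd.neg_one_zpow] at hone
  norm_num at hone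
end

section
/- For every natural number n, the n-Toffoli permutation, i.e., the permutation τ of (Fin n → Bool) × Bool defined by τ(x, t) = (x, xor t (decide (∀ i, x i = true))) (the target bit t is flipped exactly when all n control bits are true), has sign -1. -/
/-- The `n`-Toffoli permutation of basis states (flip the target bit exactly
when all `n` control bits are true) is odd, i.e. has sign `-1`. -/
theorem sign_toffoli_perm (n : ℕ) (τ : Equiv.Perm ((Fin n → Bool) × Bool))
    (hτ : ∀ (x : Fin n → Bool) (t : Bool),
      τ (x, t) = (x, xor t (decide (∀ i, x i = true)))) :
    Equiv.Perm.sign τ = -1 := by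
  have hswap : τ = Equiv.swap ((fun _ => true), false) ((fun _ => true), true) := by
    ext1 ⟨x, t⟩
    rw [hτ]
    by_cases hx : x = fun _ => true
    · subst hx
      cases t <;> simp
    · have hne : ¬ ∀ i, x i = true := fun h => hx (funext h)
      rw [Equiv.swap_apply_of_ne_of_ne (fun h => hx (congrArg Prod.fst h))
        (fun h => hx (congrArg Prod.fst h)), decide_eq_false hne, Bool.xor_false]
  rw [hswap]
  exact Equiv.Perm.sign_swap (by simp)
end

section
/- Let N ≥ 1 and let M be an N × N complex matrix with det M = -1. Then M cannot be written as the product of a finite list of N × N complex matrices each of whose determinant is of the form exp(π · i · (r / s)) for some even integer r and nonzero odd integer s. -/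
/-- The elements of a commutative division monoid killed by an odd power form a submonoid. -/
def oddTorsion (G : Type*) [DivisionCommMonoid G] : Submonoid G where
  carrier := {z | ∃ s : ℤ, Odd s ∧ z ^ s = 1}
  one_mem' := ⟨1, odd_one, one_zpow 1⟩
  mul_mem' := by
    rintro a b ⟨s, hs, ha⟩ ⟨t, ht, hb⟩
    refine ⟨s * t, hs.mul ht, ?_⟩
    rw [mul_zpow, zpow_mul, ha, zpow_mul', hb, one_zpow, one_zpow, one_mul]

theorem exp_pi_mul_I_mul_div_mem_oddTorsion {r s : ℤ} (hr : Even r) (hs : Odd s) :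
    Complex.exp (Real.pi * Complex.I * ((r : ℂ) / (s : ℂ))) ∈ oddTorsion ℂ := by
  refine ⟨s, hs, ?_⟩
  obtain ⟨k, rfl⟩ := hr
  have hs0 : (s : ℂ) ≠ 0 := by
    rw [Int.cast_ne_zero]
    rintro rfl
    exact absurd hs (by decide)
  rw [← Complex.exp_int_mul, Complex.exp_eq_one_iff]
  refine ⟨k, ?_⟩
  push_cast
  field_simp
  ring

theorem neg_one_notMem_oddTorsion : (-1 : ℂ) ∉ oddTorsion ℂ := by
  rintro ⟨s, hs, h⟩
  rw [hs.neg_one_zpow] at h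
  norm_num at h

/-- A complex `N × N` matrix (`N ≥ 1`) of determinant `-1` is not a product of
finitely many matrices each of whose determinant has the low-precision form
`exp(π i r / s)` with `r` an even integer and `s` a nonzero odd integer. -/
theorem det_neg_one_not_prod_low_precision (N : ℕ) (hN : 1 ≤ N)
    (M : Matrix (Fin N) (Fin N) ℂ) (hM : M.det = -1)
    (L : List (Matrix (Fin N) (Fin N) ℂ))
    (hL : ∀ A ∈ L, ∃ r s : ℤ, Even r ∧ s ≠ 0 ∧ Odd s ∧
      A.det = Complex.exp (Real.pi * Complex.I * ((r : ℂ) / (s : ℂ)))) :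
    M ≠ L.prod := by
  rintro rfl
  let detHom : Matrix (Fin N) (Fin N) ℂ →* ℂ := Matrix.detMonoidHom
  refine neg_one_notMem_oddTorsion (hM ▸ ?_)
  refine Submonoid.list_prod_mem ((oddTorsion ℂ).comap detHom) fun A hA => ?_
  obtain ⟨r, s, hr, -, hs, hdet⟩ := hL A hA
  rw [Submonoid.mem_comap, Matrix.coe_detMonoidHom, hdet]
  exact exp_pi_mul_I_mul_div_mem_oddTorsion hr hs
end

section
/- Let n ≥ 1 and m be natural numbers and let d : Fin m → ℂ be such that for every k, either d k = 1, or there exist an integer p and a positive integer q whose 2-adic valuation is strictly less than n with d k = exp(π · i · 2^n · p / q). Then the product ∏ k, d k is not equal to -1. -/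
theorem Finset.exists_odd_prod_pow_eq_one {ι M : Type*} [CommMonoid M] (s : Finset ι) (f : ι → M)
    (h : ∀ i ∈ s, ∃ N : ℕ, Odd N ∧ f i ^ N = 1) : ∃ N : ℕ, Odd N ∧ (∏ i ∈ s, f i) ^ N = 1 := by
  refine Finset.prod_induction f (fun x => ∃ N : ℕ, Odd N ∧ x ^ N = 1) ?_ ⟨1, odd_one, by simp⟩ h
  rintro a b ⟨M, hM, ha⟩ ⟨N, hN, hb⟩
  exact ⟨M * N, hM.mul hN, by rw [mul_pow, pow_mul, ha, mul_comm M, pow_mul, hb, one_pow, one_pow,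
    one_mul]⟩

theorem Complex.exists_odd_exp_pow_eq_one {n q : ℕ} (p : ℤ) (hq : 0 < q)
    (hv : padicValNat 2 q < n) :
    ∃ N : ℕ, Odd N ∧
      Complex.exp (Real.pi * Complex.I * 2 ^ n * (p : ℂ) / (q : ℂ)) ^ N = 1 := by
  obtain ⟨a, r, hr, rfl⟩ := Nat.exists_eq_two_pow_mul_odd hq.ne'
  have hr0 : r ≠ 0 := hr.pos.ne'
  have ha : padicValNat 2 (2 ^ a * r) = a := by
    rw [padicValNat.mul (by positivity) hr0, padicValNat.prime_pow,
      padicValNat.eq_zero_of_not_dvd hr.not_two_dvd_nat, add_zero]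
  rw [ha] at hv
  obtain ⟨c, rfl⟩ := Nat.exists_eq_add_of_lt hv
  refine ⟨r, hr, ?_⟩
  rw [← Complex.exp_nat_mul, Complex.exp_eq_one_iff]
  refine ⟨2 ^ c * p, ?_⟩
  have hrC : (r : ℂ) ≠ 0 := by exact_mod_cast hr0
  push_cast
  field_simp
  ring

/-- If each `d k` is either `1` or of the form `exp(π i 2^n p / q)` with `q`
a positive integer whose 2-adic valuation is less than `n`, then the product
of the `d k` is not `-1`. -/
theorem prod_gate_determinants_ne_neg_one (n m : ℕ) (hn : 1 ≤ n)
    (d : Fin m → ℂ)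
    (h : ∀ k, d k = 1 ∨ ∃ (p : ℤ) (q : ℕ), 0 < q ∧ padicValNat 2 q < n ∧
      d k = Complex.exp (Real.pi * Complex.I * 2 ^ n * (p : ℂ) / (q : ℂ))) :
    ∏ k, d k ≠ -1 := by
  intro hd
  obtain ⟨N, hN, hprod⟩ := Finset.univ.exists_odd_prod_pow_eq_one d fun k _ => by
    rcases h k with hk | ⟨p, q, hq, hv, hk⟩
    · exact ⟨1, odd_one, by simp [hk]⟩
    · rw [hk]
      exact Complex.exists_odd_exp_pow_eq_one p hq hv
  rw [hd, hN.neg_one_pow] at hprod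
  norm_num at hprod
end

section
/- For every natural number n, the complex permutation matrix of the n-Toffoli permutation (the permutation τ of (Fin n → Bool) × Bool defined by τ(x, t) = (x, xor t (decide (∀ i, x i = true)))) cannot be written as the product of a finite list of complex matrices (of the same size) each of whose determinant is of the form exp(π · i · (r / s)) for some even integer r and nonzero odd integer s. -/
/-- The `n`-Toffoli permutation: flip the target bit exactly when all `n`
control bits are true. -/
def toffoliPerm (n : ℕ) : Equiv.Perm ((Fin n → Bool) × Bool) :=
  Function.Involutive.toPerm
    (fun p => (p.1, xor p.2 (decide (∀ i, p.1 i = true))))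
    (by intro p; simp [Bool.xor_assoc])

theorem toffoliPerm_apply (n : ℕ) (p : (Fin n → Bool) × Bool) :
    toffoliPerm n p = (p.1, xor p.2 (decide (∀ i, p.1 i = true))) := rfl

theorem toffoliPerm_eq_swap (n : ℕ) :
    toffoliPerm n = Equiv.swap (fun _ => true, false) (fun _ => true, true) := by
  refine Equiv.ext fun p => ?_
  obtain ⟨x, t⟩ := p
  by_cases hx : ∀ i, x i = true
  · obtain rfl : x = fun _ => true := funext hx
    cases t <;> simp [toffoliPerm_apply]
  · have hne : x ≠ fun _ => true := fun h => hx fun i => congrFun h i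
    rw [Equiv.swap_apply_of_ne_of_ne (by simp [hne]) (by simp [hne])]
    simp [toffoliPerm_apply, hx]

theorem det_permMatrix_toffoliPerm (n : ℕ) :
    ((toffoliPerm n).permMatrix ℂ).det = -1 := by
  rw [Matrix.det_permutation, toffoliPerm_eq_swap, Equiv.Perm.sign_swap (by simp)]
  simp

/-- A low-precision determinant value is a root of unity of odd order. -/
theorem exists_odd_pow_exp_eq_one {r s : ℤ} (hr : Even r) (hs : Odd s) :
    ∃ m : ℕ, Odd m ∧ Complex.exp (Real.pi * Complex.I * ((r : ℂ) / (s : ℂ))) ^ m = 1 := by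
  refine ⟨s.natAbs, Int.natAbs_odd.mpr hs, ?_⟩
  have hs0 : (s : ℂ) ≠ 0 := by
    intro h
    rw [Int.cast_eq_zero.mp h] at hs
    simp at hs
  have hz : Complex.exp (Real.pi * Complex.I * ((r : ℂ) / (s : ℂ))) ^ s = 1 := by
    rw [← Complex.exp_int_mul, Complex.exp_eq_one_iff]
    obtain ⟨k, rfl⟩ := hr
    refine ⟨k, ?_⟩
    push_cast
    field_simp
    ring
  rcases Int.natAbs_eq s with h | h
  · rwa [h, zpow_natCast, ← h] at hz
  · rwa [h, zpow_neg, zpow_natCast, inv_eq_one, ← h] at hz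

theorem List.exists_odd_pow_prod_eq_one {M : Type*} [CommMonoid M] (l : List M)
    (hl : ∀ z ∈ l, ∃ m : ℕ, Odd m ∧ z ^ m = 1) : ∃ m : ℕ, Odd m ∧ l.prod ^ m = 1 := by
  induction l with
  | nil => exact ⟨1, odd_one, by simp⟩
  | cons z l ih =>
    obtain ⟨a, ha, hza⟩ := hl z (by simp)
    obtain ⟨b, hb, hlb⟩ := ih fun w hw => hl w (by simp [hw])
    refine ⟨a * b, ha.mul hb, ?_⟩
    rw [List.prod_cons, mul_pow, pow_mul, hza, one_pow, one_mul, mul_comm, pow_mul, hlb, one_pow]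

/-- The permutation matrix of the `n`-Toffoli gate is not a product of
finitely many matrices each of whose determinant has the low-precision form
`exp(π i r / s)` with `r` an even integer and `s` a nonzero odd integer. -/
theorem toffoli_not_prod_low_precision (n : ℕ)
    (L : List (Matrix ((Fin n → Bool) × Bool) ((Fin n → Bool) × Bool) ℂ))
    (hL : ∀ A ∈ L, ∃ r s : ℤ, Even r ∧ s ≠ 0 ∧ Odd s ∧
      A.det = Complex.exp (Real.pi * Complex.I * ((r : ℂ) / (s : ℂ)))) :
    (toffoliPerm n).permMatrix ℂ ≠ L.prod := by
  intro h
  have hdet : (L.map Matrix.detMonoidHom).prod = (-1 : ℂ) := by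
    rw [← map_list_prod, ← h]
    exact det_permMatrix_toffoliPerm n
  obtain ⟨m, hm, hpow⟩ := List.exists_odd_pow_prod_eq_one (L.map Matrix.detMonoidHom) (by
    intro z hz
    obtain ⟨A, hA, rfl⟩ := List.mem_map.mp hz
    obtain ⟨r, s, hr, -, hs, hrs⟩ := hL A hA
    rw [Matrix.coe_detMonoidHom, hrs]
    exact exists_odd_pow_exp_eq_one hr hs)
  rw [hdet, hm.neg_one_pow] at hpow
  norm_num at hpow
end

section
/- For every natural number n ≥ 1, the complex permutation matrix (indexed by ZMod (2^n)) of the incrementor permutation x ↦ x + 1 on ZMod (2^n) cannot be written as the product of a finite list of 2^n × 2^n complex matrices each of whose determinant is of the form exp(π · i · (r / s)) for some even integer r and nonzero odd integer s. -/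
/-- Adding one on `ZMod m` is a cycle of length `m`, so its sign is `(-1) ^ (m - 1)`. -/
theorem sign_addLeft_one_zmod (m : ℕ) [NeZero m] :
    Equiv.Perm.sign (Equiv.addLeft (1 : ZMod m)) = (-1) ^ (m - 1) := by
  obtain _ | m := m
  · exact absurd rfl (NeZero.ne 0)
  · have h : (Equiv.addLeft (1 : ZMod (m + 1)) : Equiv.Perm (Fin (m + 1))) =
        finRotate (m + 1) := by
      ext1 x
      rw [finRotate_apply]
      exact add_comm (1 : Fin (m + 1)) x
    exact (congrArg Equiv.Perm.sign h).trans (sign_finRotate (m + 1))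

/-- The complex roots of unity of odd order. -/
def oddRootsOfUnity : Submonoid ℂ where
  carrier := {z | ∃ s : ℤ, Odd s ∧ z ^ s = 1}
  one_mem' := ⟨1, odd_one, one_zpow 1⟩
  mul_mem' := by
    rintro a b ⟨s, hs, ha⟩ ⟨t, ht, hb⟩
    refine ⟨s * t, hs.mul ht, ?_⟩
    rw [mul_zpow, zpow_mul, ha, one_zpow, mul_comm s t, zpow_mul, hb, one_zpow, mul_one]

theorem neg_one_notMem_oddRootsOfUnity : (-1 : ℂ) ∉ oddRootsOfUnity := by
  rintro ⟨s, hs, h⟩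
  rw [hs.neg_one_zpow] at h
  norm_num at h

theorem exp_mem_oddRootsOfUnity {r s : ℤ} (hr : Even r) (hs : Odd s) (hs0 : s ≠ 0) :
    Complex.exp (Real.pi * Complex.I * ((r : ℂ) / (s : ℂ))) ∈ oddRootsOfUnity := by
  refine ⟨s, hs, ?_⟩
  obtain ⟨k, rfl⟩ := hr
  have hs' : (s : ℂ) ≠ 0 := Int.cast_ne_zero.mpr hs0
  rw [← Complex.exp_int_mul, Complex.exp_eq_one_iff]
  refine ⟨k, ?_⟩
  push_cast
  field_simp
  ring

/-- The permutation matrix of the incrementor `x ↦ x + 1` on `ZMod (2^n)`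
(`n ≥ 1`) is not a product of finitely many matrices each of whose determinant
has the low-precision form `exp(π i r / s)` with `r` an even integer and `s`
a nonzero odd integer. -/
theorem incrementor_not_prod_low_precision (n : ℕ) (hn : 1 ≤ n)
    (L : List (Matrix (ZMod (2 ^ n)) (ZMod (2 ^ n)) ℂ))
    (hL : ∀ A ∈ L, ∃ r s : ℤ, Even r ∧ s ≠ 0 ∧ Odd s ∧
      A.det = Complex.exp (Real.pi * Complex.I * ((r : ℂ) / (s : ℂ)))) :
    Equiv.Perm.permMatrix ℂ (Equiv.addLeft (1 : ZMod (2 ^ n))) ≠ L.prod := by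
  intro h
  have hmem : L.prod.det ∈ oddRootsOfUnity := by
    rw [← Matrix.coe_detMonoidHom, map_list_prod]
    refine Submonoid.list_prod_mem _ fun z hz => ?_
    obtain ⟨A, hA, rfl⟩ := List.mem_map.mp hz
    obtain ⟨r, s, hr, hs0, hs, hdet⟩ := hL A hA
    rw [Matrix.coe_detMonoidHom, hdet]
    exact exp_mem_oddRootsOfUnity hr hs hs0
  have hodd : Odd (2 ^ n - 1) :=
    Nat.Even.sub_odd Nat.one_le_two_pow (even_two.pow_of_ne_zero (by omega)) odd_one
  rw [← h, Matrix.det_permutation, sign_addLeft_one_zmod, hodd.neg_one_pow] at hmem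
  exact neg_one_notMem_oddRootsOfUnity (by simpa using hmem)
end

section
/- Let P be a d × d complex matrix with P * P = P, and let U be a t × t complex matrix with U * U = 1. Define the 2 × 2 complex matrices Q₀ = !![1,0;0,0], Q₁ = !![0,0;0,1], and X = !![0,1;1,0]. Set G₁ = 1 ⊗ₖ 1 ⊗ₖ Q₀ + 1 ⊗ₖ U ⊗ₖ Q₁ (the gate U on the middle register controlled by the ancilla qubit) and G₂ = (1 - P) ⊗ₖ 1 ⊗ₖ 1 + P ⊗ₖ 1 ⊗ₖ X (an X on the ancilla qubit controlled by the projector P on the first register). Then (G₂ * G₁) * (G₂ * G₁) = ((1 - P) ⊗ₖ 1 + P ⊗ₖ U) ⊗ₖ 1, i.e., the sequence G₁, G₂, G₁, G₂ implements the P-controlled U gate while acting as the identity on the ancilla qubit, regardless of the ancilla's initial state. -/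
open Kronecker in
/-- For a projector `P` and an involutive unitary `U`, the gate sequence
`G₁, G₂, G₁, G₂` (with `G₁` the ancilla-controlled `U` and `G₂` an `X` on the
ancilla controlled by `P`) implements the `P`-controlled `U` gate while acting
as the identity on the (dirty) ancilla qubit. -/
theorem controlled_U_dirty_ancilla (d t : ℕ)
    (P : Matrix (Fin d) (Fin d) ℂ) (hP : P * P = P)
    (U : Matrix (Fin t) (Fin t) ℂ) (hU : U * U = 1) :
    let Q0 : Matrix (Fin 2) (Fin 2) ℂ := !![1, 0; 0, 0]
    let Q1 : Matrix (Fin 2) (Fin 2) ℂ := !![0, 0; 0, 1]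
    let X : Matrix (Fin 2) (Fin 2) ℂ := !![0, 1; 1, 0]
    let G1 := (1 : Matrix (Fin d) (Fin d) ℂ) ⊗ₖ (1 : Matrix (Fin t) (Fin t) ℂ) ⊗ₖ Q0
        + (1 : Matrix (Fin d) (Fin d) ℂ) ⊗ₖ U ⊗ₖ Q1
    let G2 := ((1 : Matrix (Fin d) (Fin d) ℂ) - P) ⊗ₖ (1 : Matrix (Fin t) (Fin t) ℂ)
          ⊗ₖ (1 : Matrix (Fin 2) (Fin 2) ℂ)
        + P ⊗ₖ (1 : Matrix (Fin t) (Fin t) ℂ) ⊗ₖ X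
    (G2 * G1) * (G2 * G1) =
      (((1 : Matrix (Fin d) (Fin d) ℂ) - P) ⊗ₖ (1 : Matrix (Fin t) (Fin t) ℂ)
          + P ⊗ₖ U) ⊗ₖ (1 : Matrix (Fin 2) (Fin 2) ℂ) := by
  intro Q0 Q1 X G1 G2
  have hRR : (1 - P) * (1 - P) = 1 - P := by simp [mul_sub, sub_mul, hP]
  have hRP : (1 - P) * P = 0 := by simp [sub_mul, hP]
  have hPR : P * (1 - P) = 0 := by simp [mul_sub, hP]
  have h00 : Q0 * Q0 = Q0 := by ext i j; fin_cases i <;> fin_cases j <;> simp [Q0]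
  have h01 : Q0 * Q1 = 0 := by ext i j; fin_cases i <;> fin_cases j <;> simp [Q0, Q1]
  have h10 : Q1 * Q0 = 0 := by ext i j; fin_cases i <;> fin_cases j <;> simp [Q0, Q1]
  have h11 : Q1 * Q1 = Q1 := by ext i j; fin_cases i <;> fin_cases j <;> simp [Q1]
  have hX00 : X * Q0 * (X * Q0) = 0 := by
    ext i j; fin_cases i <;> fin_cases j <;> simp [X, Q0]
  have hX11 : X * Q1 * (X * Q1) = 0 := by
    ext i j; fin_cases i <;> fin_cases j <;> simp [X, Q1]
  have hX01 : X * Q0 * (X * Q1) = Q1 := by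
    ext i j; fin_cases i <;> fin_cases j <;> simp [X, Q0, Q1]
  have hX10 : X * Q1 * (X * Q0) = Q0 := by
    ext i j; fin_cases i <;> fin_cases j <;> simp [X, Q0, Q1]
  have hQ : (1 : Matrix (Fin 2) (Fin 2) ℂ) = Q0 + Q1 := by
    simp [Q0, Q1, Matrix.one_fin_two]
  have hG : G2 * G1 = (1 - P) ⊗ₖ 1 ⊗ₖ Q0 + (1 - P) ⊗ₖ U ⊗ₖ Q1
      + P ⊗ₖ 1 ⊗ₖ (X * Q0) + P ⊗ₖ U ⊗ₖ (X * Q1) := by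
    simp only [G1, G2, mul_add, add_mul, ← Matrix.mul_kronecker_mul, mul_one, one_mul]
    abel
  rw [hG, hQ]
  simp only [mul_add, add_mul, ← Matrix.mul_kronecker_mul, mul_one, one_mul, hRR, hRP, hPR,
    hP, hU, h00, h01, h10, h11, hX00, hX11, hX01, hX10, Matrix.zero_kronecker,
    Matrix.kronecker_zero, Matrix.add_kronecker, Matrix.kronecker_add, add_zero, zero_add]
  abel
end

section
/- Let n be a natural number and θ : Fin n → ℝ. For a Boolean b write [b] = 1 if b = true and [b] = 0 otherwise. Consider complex matrices indexed by (Fin n → Bool) × Bool (target bits x, control bit c): D₊ = diagonal((x,c) ↦ exp(i · (∑ j, θ j · [x j]) / 2)), D₋ = diagonal((x,c) ↦ exp(-i · (∑ j, θ j · [x j]) / 2)), F = the permutation matrix of the fan-out permutation (x, c) ↦ ((j ↦ xor (x j) c), c), and Z_c = diagonal((x,c) ↦ exp(i · (∑ j, θ j / 2) · [c])). Then Z_c * F * D₋ * F * D₊ = diagonal((x,c) ↦ exp(i · ∑ j, θ j · [x j && c])), i.e., this product equals the simultaneous application of the controlled phase gates Z(θ j) to each qubit j, all controlled by the bit c. 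-/
/-- The fan-out permutation on `(Fin n → Bool) × Bool`: flip every target bit
exactly when the control bit is true. -/
def fanoutPerm (n : ℕ) : Equiv.Perm ((Fin n → Bool) × Bool) :=
  Function.Involutive.toPerm
    (fun p => (fun j => xor (p.1 j) p.2, p.2))
    (by intro p; simp [Bool.xor_assoc])

theorem fanoutPerm_apply {n : ℕ} (p : (Fin n → Bool) × Bool) :
    fanoutPerm n p = (fun j => xor (p.1 j) p.2, p.2) :=
  rfl

/-- Conjugating a diagonal matrix by a self-inverse permutation permutes its entries. -/
theorem Equiv.Perm.permMatrix_mul_diagonal_mul_permMatrix {ι R : Type*} [Fintype ι]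
    [DecidableEq ι] [NonAssocSemiring R] (σ : Equiv.Perm ι) (hσ : σ.symm = σ) (d : ι → R) :
    σ.permMatrix R * Matrix.diagonal d * σ.permMatrix R = Matrix.diagonal (d ∘ σ) := by
  rw [Equiv.Perm.permMatrix, PEquiv.toMatrix_toPEquiv_mul, PEquiv.mul_toMatrix_toPEquiv, hσ,
    Matrix.submatrix_submatrix]
  exact Matrix.submatrix_diagonal_equiv d σ

/-- The circuit identity of Figure 3 (Lemma 4.2): `n` controlled-`Z(θ j)`
gates sharing one control qubit equal two fan-out gates interleaved with
uncontrolled half-angle phase gates, followed by a compensating phase on the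
control qubit. -/
theorem rz_fanout_identity (n : ℕ) (θ : Fin n → ℝ) :
    let Dplus : Matrix ((Fin n → Bool) × Bool) ((Fin n → Bool) × Bool) ℂ :=
      Matrix.diagonal fun p =>
        Complex.exp (Complex.I * (∑ j, (θ j : ℂ) * (if p.1 j then 1 else 0)) / 2)
    let Dminus : Matrix ((Fin n → Bool) × Bool) ((Fin n → Bool) × Bool) ℂ :=
      Matrix.diagonal fun p =>
        Complex.exp (-Complex.I * (∑ j, (θ j : ℂ) * (if p.1 j then 1 else 0)) / 2)
    let F : Matrix ((Fin n → Bool) × Bool) ((Fin n → Bool) × Bool) ℂ :=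
      (fanoutPerm n).permMatrix ℂ
    let Zc : Matrix ((Fin n → Bool) × Bool) ((Fin n → Bool) × Bool) ℂ :=
      Matrix.diagonal fun p =>
        Complex.exp (Complex.I * (∑ j, (θ j : ℂ) / 2) * (if p.2 then 1 else 0))
    Zc * F * Dminus * F * Dplus =
      Matrix.diagonal fun p =>
        Complex.exp (Complex.I * ∑ j, (θ j : ℂ) * (if p.1 j && p.2 then 1 else 0)) := by
  intro Dplus Dminus F Zc
  have h_conj : F * Dminus * F = _ :=
    (fanoutPerm n).permMatrix_mul_diagonal_mul_permMatrix rfl _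
  rw [Matrix.mul_assoc Zc, Matrix.mul_assoc Zc, h_conj, Matrix.diagonal_mul_diagonal,
    Matrix.diagonal_mul_diagonal]
  congr 1
  ext ⟨x, c⟩
  simp only [Function.comp_apply, fanoutPerm_apply]
  rw [← Complex.exp_add, ← Complex.exp_add]
  congr 1
  simp only [Finset.mul_sum, Finset.sum_mul, Finset.sum_div, ← Finset.sum_add_distrib]
  refine Finset.sum_congr rfl fun j _ => ?_
  cases c <;> by_cases h : x j <;> simp [h] <;> ring
end

section
/- Let n ≥ 6 be an even natural number. On the state space (Fin n → Bool) × Bool × Bool, with components written (x, a, t) where x are the n input bits (0-indexed), a the ancillary bit, and t the target bit, define the following maps: σ₁(x, a, t) = (x, xor a (x 0 && x 1 && x 2 && x 3), t); ν(x, a, t) = (x', a, t) where x' i = ¬(x i) for i ∈ {0,1,2,3} and x' i = x i otherwise; τ_A(x, a, t) = (Function.update x 0 (xor (x 0) (⋀_{4 ≤ j ≤ n/2+1} x j)), a, t); τ_B(x, a, t) = (Function.update x 2 (xor (x 2) (⋀_{n/2+2 ≤ j ≤ n-1} x j)), a, t); σ₃(x, a, t) = (x, a, xor t (x 0 && x 2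 && a)). Then for all x : Fin n → Bool and t : Bool, applying σ₁, ν, τ_A, τ_B, σ₃, τ_B, τ_A, ν, σ₁ in this order to (x, false, t) yields (x, false, xor t (⋀_{0 ≤ i ≤ n-1} x i)); that is, the composed map implements the n-Toffoli gate on (x, t) while returning the clean ancillary bit a to false. -/
/-- Flipping one bit twice, controlled by the same value,
restores the original word. -/
theorem update_xor_update_xor {ι : Type*} [DecidableEq ι] (w : ι → Bool) (i : ι) (b : Bool) :
    Function.update (Function.update w i (xor (w i) b)) i
      (xor (Function.update w i (xor (w i) b) i) b) = w := by
  simp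


/-- Correctness of the Theorem 3.1 construction (Figure 2): for even `n ≥ 6`,
applying the steps `σ₁, ν, τ_A, τ_B, σ₃, τ_B, τ_A, ν, σ₁` in this order to
`(x, false, t)` implements the `n`-Toffoli gate on `(x, t)` while returning
the clean ancillary bit to `false`. -/
theorem toffoli_one_clean_ancilla_correct (n : ℕ) (hn : 6 ≤ n) (hev : Even n) :
    ∀ (x : Fin n → Bool) (t : Bool),
      (let S := (Fin n → Bool) × Bool × Bool
       let i0 : Fin n := ⟨0, by omega⟩
       let i1 : Fin n := ⟨1, by omega⟩
       let i2 : Fin n := ⟨2, by omega⟩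
       let i3 : Fin n := ⟨3, by omega⟩
       -- 4-Toffoli flipping the ancilla when x₀, x₁, x₂, x₃ are all true
       let σ₁ : S → S := fun p =>
         (p.1, xor p.2.1 (p.1 i0 && p.1 i1 && p.1 i2 && p.1 i3), p.2.2)
       -- X gates on x₀, x₁, x₂, x₃
       let ν : S → S := fun p =>
         (fun i => if (i : ℕ) ≤ 3 then !(p.1 i) else p.1 i, p.2.1, p.2.2)
       -- multi-controlled Toffoli with controls 4 ≤ j ≤ n/2 + 1, target x₀
       let τA : S → S := fun p =>
         (Function.update p.1 i0
           (xor (p.1 i0)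
             (decide (∀ j : Fin n, 4 ≤ (j : ℕ) → (j : ℕ) ≤ n / 2 + 1 → p.1 j = true))),
          p.2.1, p.2.2)
       -- multi-controlled Toffoli with controls n/2 + 2 ≤ j ≤ n - 1, target x₂
       let τB : S → S := fun p =>
         (Function.update p.1 i2
           (xor (p.1 i2)
             (decide (∀ j : Fin n, n / 2 + 2 ≤ (j : ℕ) → (j : ℕ) ≤ n - 1 → p.1 j = true))),
          p.2.1, p.2.2)
       -- 3-controlled Toffoli with controls x₀, x₂, a and target t
       let σ₃ : S → S := fun p =>
         (p.1, p.2.1, xor p.2.2 (p.1 i0 && p.1 i2 && p.2.1))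
       σ₁ (ν (τA (τB (σ₃ (τB (τA (ν (σ₁ (x, false, t))))))))))
      = (x, false, xor t (decide (∀ i, x i = true))) := by
  intro x t
  extract_lets S i0 i1 i2 i3 σ₁ ν τA τB σ₃
  have h20 : i2 ≠ i0 := by simp [i0, i2]
  obtain ⟨A, hA⟩ : ∃ A : Bool, ∀ w : Fin n → Bool, (∀ j : Fin n, 4 ≤ (j : ℕ) → w j = x j) →
      decide (∀ j : Fin n, 4 ≤ (j : ℕ) → (j : ℕ) ≤ n / 2 + 1 → w j = true) = A :=
    ⟨decide (∀ j : Fin n, 4 ≤ (j : ℕ) → (j : ℕ) ≤ n / 2 + 1 → x j = true), fun w hw =>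
      decide_eq_decide.2 (forall_congr' fun j => forall_congr' fun hj => by rw [hw j hj])⟩
  obtain ⟨B, hB⟩ : ∃ B : Bool, ∀ w : Fin n → Bool, (∀ j : Fin n, 4 ≤ (j : ℕ) → w j = x j) →
      decide (∀ j : Fin n, n / 2 + 2 ≤ (j : ℕ) → (j : ℕ) ≤ n - 1 → w j = true) = B :=
    ⟨decide (∀ j : Fin n, n / 2 + 2 ≤ (j : ℕ) → (j : ℕ) ≤ n - 1 → x j = true), fun w hw =>
      decide_eq_decide.2 (forall_congr' fun j => forall_congr' fun hj => by
        rw [hw j (by omega)])⟩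
  have hτA (w : Fin n → Bool) (a s : Bool) (hw : ∀ j : Fin n, 4 ≤ (j : ℕ) → w j = x j) :
      τA (w, a, s) = (Function.update w i0 (xor (w i0) A), a, s) := by
    simp only [τA, hA w hw]
  have hτB (w : Fin n → Bool) (a s : Bool) (hw : ∀ j : Fin n, 4 ≤ (j : ℕ) → w j = x j) :
      τB (w, a, s) = (Function.update w i2 (xor (w i2) B), a, s) := by
    simp only [τB, hB w hw]
  have hupd (w : Fin n → Bool) (i : Fin n) (b : Bool) (hi : (i : ℕ) ≤ 3)
      (hw : ∀ j : Fin n, 4 ≤ (j : ℕ) → w j = x j) (j : Fin n) (hj : 4 ≤ (j : ℕ)) :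
      Function.update w i b j = x j := by
    rw [Function.update_of_ne (by rintro rfl; omega), hw j hj]
  have hi0 : (i0 : ℕ) ≤ 3 := by simp [i0]
  have hi2 : (i2 : ℕ) ≤ 3 := by simp [i2]
  set y : Fin n → Bool := fun i => if (i : ℕ) ≤ 3 then !(x i) else x i with hy
  have hyx : ∀ j : Fin n, 4 ≤ (j : ℕ) → y j = x j := fun j hj => by
    simp only [hy]; rw [if_neg (by omega)]
  have hyA := hupd y i0 (xor (y i0) A) hi0 hyx
  have hyAB := hupd _ i2 (xor (Function.update y i0 (xor (y i0) A) i2) B) hi2 hyA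
  have hy0 : y i0 = !(x i0) := if_pos hi0
  have hy2 : y i2 = !(x i2) := if_pos hi2
  have hνy (a s : Bool) : ν (y, a, s) = (x, a, s) := by
    refine Prod.ext (funext fun i => ?_) rfl
    simp only [ν, hy]
    split_ifs <;> simp
  have hνx (a s : Bool) : ν (x, a, s) = (y, a, s) := rfl
  have hσ₁ (a s : Bool) : σ₁ (x, a, s) = (x, xor a (x i0 && x i1 && x i2 && x i3), s) := rfl
  have hσ₃ (w : Fin n → Bool) (a s : Bool) :
      σ₃ (w, a, s) = (w, a, xor s (w i0 && w i2 && a)) := rfl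
  have hall : decide (∀ i, x i = true) = (x i0 && x i1 && x i2 && x i3 && A && B) := by
    rw [← hA x fun _ _ => rfl, ← hB x fun _ _ => rfl, Bool.eq_iff_iff]
    simp only [Bool.and_eq_true, decide_eq_true_eq]
    refine ⟨fun h => by simp [h], ?_⟩
    rintro ⟨⟨⟨⟨⟨h0, h1⟩, h2⟩, h3⟩, hlow⟩, hhigh⟩ ⟨j, hj⟩
    rcases Nat.lt_or_ge j 4 with h4 | h4
    · interval_cases j <;> assumption
    · rcases Nat.lt_or_ge j (n / 2 + 2) with h | h
      · exact hlow _ h4 (by simp only; omega)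
      · exact hhigh _ h (by simp only; omega)
  rw [hσ₁, hνx, hτA _ _ _ hyx, hτB _ _ _ hyA, hσ₃, hτB _ _ _ hyAB, update_xor_update_xor,
    hτA _ _ _ hyA, update_xor_update_xor, hνy, hσ₁, hall]
  simp only [Function.update_self, Function.update_of_ne h20, Function.update_of_ne h20.symm,
    hy0, hy2]
  cases x i0 <;> cases x i1 <;> cases x i2 <;> cases x i3 <;> simp
end
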